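/- arXiv:1903.11057 — 7 statements merged into one kernel-verified Lean document; each statement's English description precedes it below -/
import Mathlib

section
/- For all integers r, s, n, m: u(r−s)·w(n+m) = u(m−s)·w(n+r) − q^(r−s)·u(m−r)·w(n+s). -/
/-- A two-sided second-order linear recurrence vanishing at `0` and `1` vanishes everywhere. -/
theorem eq_zero_of_recurrence {p q : ℂ} (hq : q ≠ 0) {f : ℤ → ℂ}
    (hf : ∀ n : ℤ, f n = p * f (n - 1) - q * f (n - 2)) (h0 : f 0 = 0) (h1 : f 1 = 0) (n : ℤ) :
    f n = 0 := by
  suffices h : f n = 0 ∧ f (n + 1) = 0 from h.1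
  induction n using Int.induction_on with
  | zero => exact ⟨h0, by simpa using h1⟩
  | succ k ih =>
    refine ⟨ih.2, ?_⟩
    have h := hf (k + 1 + 1)
    rw [show (k + 1 + 1 - 1 : ℤ) = k + 1 by ring, show (k + 1 + 1 - 2 : ℤ) = k by ring,
      ih.1, ih.2] at h
    simpa using h
  | pred k ih =>
    have h := hf (-k + 1)
    rw [show (-k + 1 - 1 : ℤ) = -k by ring, show (-k + 1 - 2 : ℤ) = -k - 1 by ring,
      ih.1, ih.2] at h
    refine ⟨?_, by simpa using ih.1⟩
    simpa [hq] using h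

/-- Reflection formula for the Lucas sequence of the first kind. -/
theorem zpow_mul_lucas_neg {p q : ℂ} (hq : q ≠ 0) {u : ℤ → ℂ} (hu0 : u 0 = 0) (hu1 : u 1 = 1)
    (hu : ∀ n : ℤ, u n = p * u (n - 1) - q * u (n - 2)) (k : ℤ) :
    q ^ k * u (-k) = -u k := by
  have hneg : q * u (-1) = -1 := by
    have h := hu 1
    norm_num [hu0, hu1] at h
    linear_combination h
  refine eq_neg_of_add_eq_zero_left
    (eq_zero_of_recurrence (p := p) (f := fun k ↦ q ^ k * u (-k) + u k) hq (fun n ↦ ?_) ?_ ?_ k)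
  · have h := hu (-n + 2)
    rw [show -n + 2 - 1 = -(n - 1) by ring, show -n + 2 - 2 = -n by ring,
      show -n + 2 = -(n - 2) by ring] at h
    have e1 : q ^ (n - 1) = q ^ (n - 2) * q := by
      rw [← zpow_add_one₀ hq]; congr 1; ring
    have e2 : q ^ n = q ^ (n - 2) * q * q := by
      rw [← e1, ← zpow_add_one₀ hq]; congr 1; ring
    simp only [e1, e2]
    linear_combination hu n + q ^ (n - 2) * q * h
  · simp [hu0]
  · simp [hu1, hneg]

/-- Addition formula expressing a Horadam sequence through the Lucas sequence. -/
theorem horadam_add {p q : ℂ} (hq : q ≠ 0) {w u : ℤ → ℂ}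
    (hw : ∀ n : ℤ, w n = p * w (n - 1) - q * w (n - 2)) (hu0 : u 0 = 0) (hu1 : u 1 = 1)
    (hu : ∀ n : ℤ, u n = p * u (n - 1) - q * u (n - 2)) (n k : ℤ) :
    w (n + k) = u k * w (n + 1) - q * u (k - 1) * w n := by
  refine eq_of_sub_eq_zero (eq_zero_of_recurrence (p := p)
    (f := fun k ↦ w (n + k) - (u k * w (n + 1) - q * u (k - 1) * w n)) hq (fun k ↦ ?_) ?_ ?_ k)
  · have h1 := hw (n + k)
    have h2 := hu (k - 1)
    rw [show k - 1 - 2 = k - 2 - 1 by ring] at h2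
    rw [add_sub_assoc, add_sub_assoc] at h1
    linear_combination h1 - w (n + 1) * hu k + q * w n * h2
  · have h := hu 1
    norm_num [hu0, hu1] at h
    norm_num [hu0]
    linear_combination w n * h
  · simp [hu0, hu1]

theorem stmt_0 (p q a b : ℂ) (hq : q ≠ 0) (w u : ℤ → ℂ)
    (hw0 : w 0 = a) (hw1 : w 1 = b)
    (hw : ∀ n : ℤ, w n = p * w (n - 1) - q * w (n - 2))
    (hu0 : u 0 = 0) (hu1 : u 1 = 1)
    (hu : ∀ n : ℤ, u n = p * u (n - 1) - q * u (n - 2))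
    (r s n m : ℤ) :
    u (r - s) * w (n + m) = u (m - s) * w (n + r) - q ^ (r - s) * u (m - r) * w (n + s) := by
  have hm := horadam_add hq hw hu0 hu1 hu (n + s) (m - s)
  have hr := horadam_add hq hw hu0 hu1 hu (n + s) (r - s)
  have hd := horadam_add hq hu hu0 hu1 hu (-(r - s)) (m - s)
  have h1 := zpow_mul_lucas_neg hq hu0 hu1 hu (r - s)
  have h2 := zpow_mul_lucas_neg hq hu0 hu1 hu (r - s - 1)
  have e : q ^ (r - s) = q ^ (r - s - 1) * q := by
    rw [← zpow_add_one₀ hq, sub_add_cancel]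
  rw [show n + s + (m - s) = n + m by ring] at hm
  rw [show n + s + (r - s) = n + r by ring] at hr
  rw [show -(r - s) + (m - s) = m - r by ring, show -(r - s) + 1 = -(r - s - 1) by ring] at hd
  linear_combination u (r - s) * hm - u (m - s) * hr + q ^ (r - s) * w (n + s) * hd
    + u (m - s) * u (-(r - s - 1)) * w (n + s) * e + q * u (m - s) * w (n + s) * h2
    - q * u (m - s - 1) * w (n + s) * h1
end

section
/- For all integers r, s, n, m: u(r−s)·w(n+m) = u(n+r)·w(m−s) − q^(r−s)·u(n+s)·w(m−r). -/
/-- A two-sided solution of a second-order linear recurrence vanishes if two consecutive values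
vanish. -/
theorem eq_zero_of_horadam_recurrence {p q : ℂ} (hq : q ≠ 0) {f : ℤ → ℂ}
    (hf : ∀ n : ℤ, f (n + 2) = p * f (n + 1) - q * f n) (h0 : f 0 = 0) (h1 : f 1 = 0) (n : ℤ) :
    f n = 0 := by
  suffices h : f n = 0 ∧ f (n + 1) = 0 from h.1
  induction n using Int.induction_on with
  | zero => exact ⟨h0, by simpa using h1⟩
  | succ k ih =>
    refine ⟨ih.2, ?_⟩
    rw [show (k : ℤ) + 1 + 1 = k + 2 by ring, hf, ih.1, ih.2]
    ring
  | pred k ih =>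
    have h := hf (-(k : ℤ) - 1)
    rw [show -(k : ℤ) - 1 + 2 = -k + 1 by ring, sub_add_cancel, ih.1, ih.2] at h
    refine ⟨?_, by rw [sub_add_cancel, ih.1]⟩
    have hz : q * f (-(k : ℤ) - 1) = 0 := by linear_combination h
    exact (mul_eq_zero.mp hz).resolve_left hq

/-- The Casoratian of a Lucas sequence and a shifted Horadam sequence. -/
theorem lucas_horadam_casoratian {p q : ℂ} (hq : q ≠ 0) {w u : ℤ → ℂ}
    (hw : ∀ n : ℤ, w (n + 2) = p * w (n + 1) - q * w n)
    (hu0 : u 0 = 0) (hu1 : u 1 = 1)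
    (hu : ∀ n : ℤ, u (n + 2) = p * u (n + 1) - q * u n) (m k : ℤ) :
    u (k + 1) * w (m + k) - u k * w (m + k + 1) = q ^ k * w m := by
  have step (j : ℤ) : u (j + 1 + 1) * w (m + (j + 1)) - u (j + 1) * w (m + (j + 1) + 1)
      = q * (u (j + 1) * w (m + j) - u j * w (m + j + 1)) := by
    rw [show j + 1 + 1 = j + 2 by ring, show m + (j + 1) + 1 = m + j + 2 by ring,
      show m + (j + 1) = m + j + 1 by ring, hu, hw]
    ring
  induction k using Int.induction_on with
  | zero => simp [hu0, hu1]
  | succ k ih =>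
    rw [step, ih, zpow_add_one₀ hq]
    ring
  | pred k ih =>
    have h := step (-(k : ℤ) - 1)
    rw [sub_add_cancel, ih] at h
    apply mul_left_cancel₀ hq
    rw [sub_add_cancel, ← h, zpow_sub_one₀ hq]
    field_simp

theorem stmt_2 (p q a b : ℂ) (hq : q ≠ 0) (w u : ℤ → ℂ)
    (hw0 : w 0 = a) (hw1 : w 1 = b)
    (hw : ∀ n : ℤ, w n = p * w (n - 1) - q * w (n - 2))
    (hu0 : u 0 = 0) (hu1 : u 1 = 1)
    (hu : ∀ n : ℤ, u n = p * u (n - 1) - q * u (n - 2))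
    (r s n m : ℤ) :
    u (r - s) * w (n + m) = u (n + r) * w (m - s) - q ^ (r - s) * u (n + s) * w (m - r) := by
  have hw' (n : ℤ) : w (n + 2) = p * w (n + 1) - q * w n := by
    rw [hw (n + 2), show n + 2 - 1 = n + 1 by ring, add_sub_cancel_right]
  have hu' (n : ℤ) : u (n + 2) = p * u (n + 1) - q * u n := by
    rw [hu (n + 2), show n + 2 - 1 = n + 1 by ring, add_sub_cancel_right]
  obtain ⟨k, rfl⟩ : ∃ k, r = s + k := ⟨r - s, by ring⟩
  obtain ⟨l, rfl⟩ : ∃ l, m = l + (s + k) := ⟨m - (s + k), by ring⟩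
  have key := eq_zero_of_horadam_recurrence hq
    (f := fun j => u (k + j) * w (l + k) - q ^ k * u j * w l - u k * w (l + k + j))
    (fun j => by
      simp only [← add_assoc, hu', hw']
      ring)
    (by simp [hu0])
    (by
      simp only [hu1]
      linear_combination lucas_horadam_casoratian hq hw' hu0 hu1 hu' l k)
    (n + s)
  rw [show s + k - s = k by ring, show n + (l + (s + k)) = l + k + (n + s) by ring,
    show n + (s + k) = k + (n + s) by ring, show l + (s + k) - s = l + k by ring,
    add_sub_cancel_right]
  linear_combination -key
end

section
/- For all integers r, s, n, m: u(r−s)·w(n+m) = u(m+r)·w(n−s) − q^(r−s)·u(m+s)·w(n−r). -/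
/-- A two-sided solution of a second-order linear recurrence with invertible trailing coefficient
vanishes identically as soon as it vanishes at `0` and `1`. -/
theorem eq_zero_of_linear_recurrence {K : Type*} [Field K] {p q : K} (hq : q ≠ 0) {x : ℤ → K}
    (hx : ∀ n : ℤ, x (n + 2) = p * x (n + 1) - q * x n) (h0 : x 0 = 0) (h1 : x 1 = 0) (n : ℤ) :
    x n = 0 := by
  suffices h : x n = 0 ∧ x (n + 1) = 0 from h.1
  induction n using Int.induction_on with
  | zero => exact ⟨h0, by simpa using h1⟩
  | succ i ih =>
    refine ⟨ih.2, ?_⟩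
    rw [add_assoc, one_add_one_eq_two, hx, ih.1, ih.2]
    ring
  | pred i ih =>
    have h := hx (-(i : ℤ) - 1)
    rw [show -(i : ℤ) - 1 + 2 = -i + 1 by ring, sub_add_cancel, ih.1, ih.2] at h
    refine ⟨?_, by rw [sub_add_cancel]; exact ih.1⟩
    have h' : q * x (-(i : ℤ) - 1) = 0 := by linear_combination h
    exact (mul_eq_zero.mp h').resolve_left hq

/-- Reflecting a Horadam sequence `w` about `n`: the sequence `k ↦ q ^ k * w (n - k)` is expressed
through the Lucas sequence `u`. -/
theorem lucas_mul_horadam_succ {K : Type*} [Field K] {p q : K} (hq : q ≠ 0) {w u : ℤ → K}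
    (hw : ∀ n : ℤ, w (n + 2) = p * w (n + 1) - q * w n) (hu0 : u 0 = 0) (hu1 : u 1 = 1)
    (hu : ∀ n : ℤ, u (n + 2) = p * u (n + 1) - q * u n) (k n : ℤ) :
    u k * w (n + 1) = u (k + 1) * w n - q ^ k * w (n - k) := by
  have hu2 : u 2 = p := by simpa [hu0, hu1] using hu 0
  refine sub_eq_zero.mp (eq_zero_of_linear_recurrence (p := p) hq
    (x := fun k ↦ u k * w (n + 1) - (u (k + 1) * w n - q ^ k * w (n - k))) (fun k ↦ ?_) ?_ ?_ k)
  · have h₁ := hu k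
    have h₂ := hu (k + 1)
    have h₃ := hw (n - (k + 2))
    rw [show k + 1 + 2 = k + 2 + 1 by ring] at h₂
    rw [show n - (k + 2) + 2 = n - k by ring, show n - (k + 2) + 1 = n - (k + 1) by ring] at h₃
    have e₁ : q ^ (k + 1) = q ^ k * q := zpow_add_one₀ hq k
    have e₂ : q ^ (k + 2) = q ^ k * q ^ 2 := by
      rw [zpow_add₀ hq]
      norm_cast
    simp only [e₁, e₂]
    linear_combination w (n + 1) * h₁ - w n * h₂ + q ^ k * q * h₃
  · simp [hu0, hu1]
  · have h := hw (n - 1)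
    rw [show n - 1 + 2 = n + 1 by ring, sub_add_cancel] at h
    simp only [one_add_one_eq_two, hu1, hu2, zpow_one]
    linear_combination h

theorem stmt_3 (p q a b : ℂ) (hq : q ≠ 0) (w u : ℤ → ℂ)
    (hw0 : w 0 = a) (hw1 : w 1 = b)
    (hw : ∀ n : ℤ, w n = p * w (n - 1) - q * w (n - 2))
    (hu0 : u 0 = 0) (hu1 : u 1 = 1)
    (hu : ∀ n : ℤ, u n = p * u (n - 1) - q * u (n - 2))
    (r s n m : ℤ) :
    u (r - s) * w (n + m) = u (m + r) * w (n - s) - q ^ (r - s) * u (m + s) * w (n - r) := by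
  have shift {v : ℤ → ℂ} (hv : ∀ n : ℤ, v n = p * v (n - 1) - q * v (n - 2)) (n : ℤ) :
      v (n + 2) = p * v (n + 1) - q * v n := by
    rw [hv (n + 2), show n + 2 - 1 = n + 1 by ring, add_sub_cancel_right]
  have h := eq_zero_of_linear_recurrence (p := p) hq
    (x := fun j ↦ u (r - s) * w (n - s + j)
      - (u (r - s + j) * w (n - s) - q ^ (r - s) * u j * w (n - r)))
    (fun j ↦ ?_) ?_ ?_ (m + s)
  · simp only [show n - s + (m + s) = n + m by ring, show r - s + (m + s) = m + r by ring] at h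
    exact sub_eq_zero.mp h
  · simp only [← add_assoc, shift hw, shift hu]
    ring
  · simp [hu0]
  · have h := lucas_mul_horadam_succ hq (shift hw) hu0 hu1 (shift hu) (r - s) (n - s)
    rw [sub_sub_sub_cancel_right] at h
    simp only [hu1]
    linear_combination h
end

section
/- For all integers n and m: w(n+m) = u(m)·w(n+1) − q·u(m−1)·w(n). -/
/-- Two solutions of a second-order linear recurrence on `ℤ` that agree at `0` and `1` are equal. -/
theorem eq_of_second_order_recurrence {K : Type*} [Field K] {p q : K} (hq : q ≠ 0) {x y : ℤ → K}
    (hx : ∀ n : ℤ, x n = p * x (n - 1) - q * x (n - 2))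
    (hy : ∀ n : ℤ, y n = p * y (n - 1) - q * y (n - 2))
    (h0 : x 0 = y 0) (h1 : x 1 = y 1) : x = y := by
  have key (m : ℤ) : x m = y m ∧ x (m + 1) = y (m + 1) := by
    induction m with
    | zero => simpa using ⟨h0, h1⟩
    | succ i ih =>
      refine ⟨ih.2, ?_⟩
      rw [hx, hy, show (i : ℤ) + 1 + 1 - 1 = i + 1 by ring, show (i : ℤ) + 1 + 1 - 2 = i by ring,
        ih.1, ih.2]
    | pred i ih =>
      have e := ih.2
      rw [hx, hy, show -(i : ℤ) + 1 - 1 = -i by ring, show -(i : ℤ) + 1 - 2 = -i - 1 by ring,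
        ih.1] at e
      exact ⟨mul_left_cancel₀ hq (sub_right_injective e), by simpa using ih.1⟩
  exact funext fun m => (key m).1

theorem stmt_6 (p q a b : ℂ) (hq : q ≠ 0) (w u : ℤ → ℂ)
    (hw0 : w 0 = a) (hw1 : w 1 = b)
    (hw : ∀ n : ℤ, w n = p * w (n - 1) - q * w (n - 2))
    (hu0 : u 0 = 0) (hu1 : u 1 = 1)
    (hu : ∀ n : ℤ, u n = p * u (n - 1) - q * u (n - 2))
    (n m : ℤ) :
    w (n + m) = u m * w (n + 1) - q * u (m - 1) * w n := by
  have hu_neg_one : q * u (-1) = -1 := by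
    have h := hu 1
    norm_num [hu0, hu1] at h
    linear_combination h
  refine congrFun (eq_of_second_order_recurrence (p := p) hq (x := fun m => w (n + m))
    (y := fun m => u m * w (n + 1) - q * u (m - 1) * w n) (fun k => ?_) (fun k => ?_) ?_ ?_) m
  · simpa only [add_sub_assoc] using hw (n + k)
  · have h := hu (k - 1)
    rw [sub_right_comm k 1 2] at h
    linear_combination w (n + 1) * hu k - q * w n * h
  · simp [hu0, hu_neg_one]
  · simp [hu0, hu1]
end

section
/- For every integer n: q^n·w(−n) = a·v(n) − w(n). -/
/-- A two-sided solution of a second-order linear recurrence with invertible trailing coefficient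
vanishes as soon as it vanishes at `0` and `1`. -/
theorem eq_zero_of_two_sided_recurrence {K : Type*} [Field K] {p q : K} (hq : q ≠ 0) {d : ℤ → K}
    (hd : ∀ n : ℤ, d n = p * d (n - 1) - q * d (n - 2)) (h0 : d 0 = 0) (h1 : d 1 = 0) (n : ℤ) :
    d n = 0 := by
  suffices h : d n = 0 ∧ d (n + 1) = 0 from h.1
  induction n using Int.induction_on with
  | zero => exact ⟨h0, by simpa using h1⟩
  | succ k ih =>
    refine ⟨ih.2, ?_⟩
    rw [hd, show (k : ℤ) + 1 + 1 - 1 = k + 1 by ring, show (k : ℤ) + 1 + 1 - 2 = k by ring,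
      ih.1, ih.2]
    ring
  | pred k ih =>
    have h := hd (-(k : ℤ) + 1)
    rw [show -(k : ℤ) + 1 - 1 = -k by ring, show -(k : ℤ) + 1 - 2 = -k - 1 by ring,
      ih.1, ih.2] at h
    refine ⟨?_, by simpa using ih.1⟩
    simpa [hq] using h

/-- Reflecting a solution `w` of `w n = p * w (n - 1) - q * w (n - 2)` and rescaling by `q ^ n`
gives another solution. -/
theorem zpow_mul_neg_recurrence {K : Type*} [Field K] {p q : K} (hq : q ≠ 0) {w : ℤ → K}
    (hw : ∀ n : ℤ, w n = p * w (n - 1) - q * w (n - 2)) (n : ℤ) :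
    q ^ n * w (-n) =
      p * (q ^ (n - 1) * w (-(n - 1))) - q * (q ^ (n - 2) * w (-(n - 2))) := by
  have h := hw (-(n - 2))
  rw [show -(n - 2) - 1 = -(n - 1) by ring, show -(n - 2) - 2 = -n by ring] at h
  have e1 : q ^ (n - 1) = q ^ (n - 2) * q := by
    rw [← zpow_add_one₀ hq]; congr 1; ring
  have e2 : q ^ n = q ^ (n - 2) * q * q := by
    rw [← e1, ← zpow_add_one₀ hq]; congr 1; ring
  rw [e1, e2]
  linear_combination (q ^ (n - 2) * q) * h

theorem stmt_8 (p q a b : ℂ) (hq : q ≠ 0) (w v : ℤ → ℂ)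
    (hw0 : w 0 = a) (hw1 : w 1 = b)
    (hw : ∀ n : ℤ, w n = p * w (n - 1) - q * w (n - 2))
    (hv0 : v 0 = 2) (hv1 : v 1 = p)
    (hv : ∀ n : ℤ, v n = p * v (n - 1) - q * v (n - 2))
    (n : ℤ) :
    q ^ n * w (-n) = a * v n - w n := by
  rw [← sub_eq_zero]
  refine eq_zero_of_two_sided_recurrence (p := p) (d := fun m => q ^ m * w (-m) - (a * v m - w m)) hq
    (fun m => ?_) ?_ ?_ n
  · linear_combination zpow_mul_neg_recurrence hq hw m - a * hv m + hw m
  · simp only [neg_zero, zpow_zero, hw0, hv0]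
    ring
  · have h := hw 1
    rw [show (1 : ℤ) - 1 = 0 by ring, show (1 : ℤ) - 2 = -1 by ring, hw0, hw1] at h
    simp only [zpow_one, hv1, hw1]
    linear_combination h
end

section
/- Let X, Y : ℤ → ℂ be sequences, let h, f₁, f₂ be nonzero complex numbers, and let c, d be integers such that h·X(n) = f₁·X(n−c) + f₂·Y(n−d) for every integer n. Fix an integer n and a natural number k, and assume that X(n−ck+cj) ≠ 0 and X(n−c−ck+cj) ≠ 0 for every j with 0 ≤ j ≤ k. Then X(n)·X(n−c(k+1))·f₂·∑_{j=0}^{k} h^{k−j}·f₁^{j}·Y(n−d−ck+cj)/(X(n−ck+cj)·X(n−c−ck+cj)) = h^{k+1}·X(n) − f₁^{k+1}·X(n−c(k+1)). -/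
theorem stmt_12 (X Y : ℤ → ℂ) (h f₁ f₂ : ℂ) (hh : h ≠ 0) (hf₁ : f₁ ≠ 0) (hf₂ : f₂ ≠ 0)
    (c d : ℤ) (hrec : ∀ n : ℤ, h * X n = f₁ * X (n - c) + f₂ * Y (n - d))
    (n : ℤ) (k : ℕ)
    (hX1 : ∀ j : ℕ, j ≤ k → X (n - c * k + c * j) ≠ 0)
    (hX2 : ∀ j : ℕ, j ≤ k → X (n - c - c * k + c * j) ≠ 0) :
    X n * X (n - c * (k + 1)) * f₂ * ∑ j ∈ Finset.range (k + 1), h ^ (k - j) * f₁ ^ j * Y (n - d - c * k + c * j) / (X (n - c * k + c * j) * X (n - c - c * k + c * j)) = h ^ (k + 1) * X n - f₁ ^ (k + 1) * X (n - c * (k + 1)) := by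
  have telescope : f₂ * ∑ j ∈ Finset.range (k + 1), h ^ (k - j) * f₁ ^ j *
      Y (n - d - c * k + c * j) / (X (n - c * k + c * j) * X (n - c - c * k + c * j)) =
      h ^ (k + 1) / X (n - c * (k + 1)) - f₁ ^ (k + 1) / X n := by
    let B : ℕ → ℂ := fun j => h ^ (k + 1 - j) * f₁ ^ j / X (n - c - c * k + c * j)
    have hB0 : B 0 = h ^ (k + 1) / X (n - c * (k + 1)) := by
      have hi : n - c - c * k + c * (0 : ℕ) = n - c * (k + 1) := by push_cast; ring
      simp only [B, hi, Nat.sub_zero, pow_zero, mul_one]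
    have hBk : B (k + 1) = f₁ ^ (k + 1) / X n := by
      have hi : n - c - c * k + c * (k + 1 : ℕ) = n := by push_cast; ring
      simp only [B, hi, Nat.sub_self, pow_zero, one_mul]
    rw [← hB0, ← hBk, ← Finset.sum_range_sub', Finset.mul_sum]
    refine Finset.sum_congr rfl fun j hj => ?_
    have hjk : j ≤ k := Nat.lt_succ_iff.mp (Finset.mem_range.mp hj)
    have h1 := hX1 j hjk
    have h2 := hX2 j hjk
    have hr := hrec (n - c * k + c * j)
    rw [show n - c * k + c * j - c = n - c - c * k + c * j by ring,
      show n - c * k + c * j - d = n - d - c * k + c * j by ring] at hr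
    have hi : n - c - c * k + c * (j + 1 : ℕ) = n - c * k + c * j := by push_cast; ring
    simp only [B, hi, show k + 1 - j = k - j + 1 by omega,
      show k + 1 - (j + 1) = k - j by omega]
    field_simp
    linear_combination -(h ^ (k - j) * f₁ ^ j) * hr
  have hXn : X n ≠ 0 := by
    have := hX1 k le_rfl
    rwa [sub_add_cancel] at this
  have hXlast : X (n - c * (k + 1)) ≠ 0 := by
    have := hX2 0 k.zero_le
    rwa [show n - c - c * k + c * (0 : ℕ) = n - c * (k + 1) by push_cast; ring] at this
  rw [mul_assoc, telescope]
  field_simp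
end

section
/- For every natural number k and all integers r, s, n, m: ∑_{j=0}^{k} (−1)^j·C(k,j)·u(r−s)^j·u(m−s)^{k−j}·w(n+(r−s)k+(m−r)j) = q^{(r−s)k}·u(m−r)^k·w(n), where C(k,j) is the binomial coefficient. -/
/-- A two-sided second order linear recurrence with two consecutive zeros vanishes identically. -/
lemma recurrence_eq_zero {K : Type*} [Field K] {p q : K} (hq : q ≠ 0) {f : ℤ → K}
    (hf : ∀ n, f (n + 2) = p * f (n + 1) - q * f n) {c : ℤ} (h0 : f c = 0) (h1 : f (c + 1) = 0)
    (n : ℤ) : f n = 0 := by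
  have key : ∀ i : ℤ, f (c + i) = 0 ∧ f (c + i + 1) = 0 := by
    intro i
    induction i with
    | zero => simpa using ⟨h0, h1⟩
    | succ i ih =>
      refine ⟨by rw [← add_assoc]; exact ih.2, ?_⟩
      have h := hf (c + i)
      rw [ih.1, ih.2] at h
      rw [show c + ((i : ℤ) + 1) + 1 = c + i + 2 by ring, h]
      ring
    | pred i ih =>
      have h := hf (c + (-(i : ℤ) - 1))
      rw [show c + (-(i : ℤ) - 1) + 2 = c + -(i : ℤ) + 1 by ring,
        show c + (-(i : ℤ) - 1) + 1 = c + -(i : ℤ) by ring, ih.1, ih.2] at h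
      rw [show c + (-(i : ℤ) - 1) + 1 = c + -(i : ℤ) by ring]
      refine ⟨?_, ih.1⟩
      have h' : q * f (c + (-(i : ℤ) - 1)) = 0 := by linear_combination h
      exact (mul_eq_zero.mp h').resolve_left hq
  simpa using (key (n - c)).1

/-- A d'Ocagne type identity for a Horadam sequence and the Lucas sequence of the first kind. -/
lemma horadam_docagne {K : Type*} [Field K] {p q : K} (hq : q ≠ 0) {w u : ℤ → K}
    (hw : ∀ n, w (n + 2) = p * w (n + 1) - q * w n)
    (hu : ∀ n, u (n + 2) = p * u (n + 1) - q * u n) (hu0 : u 0 = 0) (hu1 : u 1 = 1)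
    (n x y : ℤ) : u y * w (n + x) - u x * w (n + y) = q ^ x * u (y - x) * w n := by
  have consecutive : ∀ x : ℤ, u (x + 1) * w (n + x) - u x * w (n + x + 1) = q ^ x * w n := by
    have step : ∀ x : ℤ, u (x + 2) * w (n + x + 1) - u (x + 1) * w (n + x + 2) =
        q * (u (x + 1) * w (n + x) - u x * w (n + x + 1)) := by
      intro x
      rw [hu, hw]
      ring
    intro x
    induction x with
    | zero => simp [hu0, hu1]
    | succ i ih =>
      have h := step i
      rw [ih] at h
      rw [show (i : ℤ) + 1 + 1 = i + 2 by ring, show n + ((i : ℤ) + 1) = n + i + 1 by ring,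
        show n + (i : ℤ) + 1 + 1 = n + i + 2 by ring, h, zpow_add_one₀ hq]
      ring
    | pred i ih =>
      have h := step (-(i : ℤ) - 1)
      rw [show -(i : ℤ) - 1 + 2 = -i + 1 by ring, show n + (-(i : ℤ) - 1) + 1 = n + -i by ring,
        show -(i : ℤ) - 1 + 1 = -i by ring,
        show n + (-(i : ℤ) - 1) + 2 = n + -i + 1 by ring, ih] at h
      rw [show n + (-(i : ℤ) - 1) + 1 = n + -i by ring, show -(i : ℤ) - 1 + 1 = -i by ring]
      apply mul_left_cancel₀ hq
      rw [← h, zpow_sub_one₀ hq]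
      field_simp
  refine sub_eq_zero.mp (recurrence_eq_zero hq (p := p) (c := x)
    (f := fun y => u y * w (n + x) - u x * w (n + y) - q ^ x * u (y - x) * w n) ?_ ?_ ?_ y)
  · intro y
    rw [show y + 2 - x = y - x + 2 by ring, show y + 1 - x = y - x + 1 by ring,
      ← add_assoc, ← add_assoc, hu, hu, hw]
    ring
  · simp [hu0]
  · have h := consecutive x
    simp only [add_sub_cancel_left, hu1, ← add_assoc]
    linear_combination h

/-- Iterating a two-term shift relation `k` times yields a binomial sum. -/
lemma sum_choose_mul_shift {K : Type*} [CommRing K] {f : ℤ → K} {c d e : K} {x y : ℤ}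
    (h : ∀ n, c * f (n + x) + d * f (n + y) = e * f n) (k : ℕ) (n : ℤ) :
    ∑ j ∈ Finset.range (k + 1),
      d ^ j * c ^ (k - j) * (k.choose j : K) * f (n + x * (k - j : ℕ) + y * j) = e ^ k * f n := by
  let E : ℤ → Module.End K (ℤ → K) := fun z => LinearMap.funLeft K K (· + z)
  have E_pow : ∀ (z : ℤ) (i : ℕ) (g : ℤ → K) (n : ℤ), (E z ^ i) g n = g (n + z * i) := by
    intro z i
    induction i with
    | zero => simp
    | succ i ih =>
      intro g n
      rw [pow_succ, Module.End.mul_apply, ih]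
      simp only [E, LinearMap.funLeft_apply]
      congr 1
      push_cast
      ring
  have commute_E : Commute (d • E y) (c • E x) := by
    refine Commute.smul_left (Commute.smul_right ?_ c) d
    ext g n
    simp only [E, Module.End.mul_apply, LinearMap.funLeft_apply]
    rw [add_right_comm]
  have iterate : ∀ k : ℕ, ((d • E y + c • E x) ^ k) f = e ^ k • f := by
    have base : (d • E y + c • E x) f = e • f := by
      ext n
      simpa [E, add_comm] using h n
    intro k
    induction k with
    | zero => simp
    | succ k ih => rw [pow_succ, Module.End.mul_apply, base, map_smul, ih, smul_smul, pow_succ']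
  have main := congrFun (iterate k) n
  rw [commute_E.add_pow, LinearMap.sum_apply, Finset.sum_apply] at main
  rw [Pi.smul_apply, smul_eq_mul] at main
  rw [← main]
  refine Finset.sum_congr rfl fun j _ => ?_
  rw [← nsmul_eq_mul' ((d • E y) ^ j * (c • E x) ^ (k - j)), smul_pow, smul_pow, smul_mul_smul_comm]
  simp only [LinearMap.smul_apply, Pi.smul_apply, Module.End.mul_apply, E_pow, smul_eq_mul]
  rw [nsmul_eq_mul, add_right_comm]
  ring

theorem stmt_15 (p q a b : ℂ) (hq : q ≠ 0) (w u : ℤ → ℂ)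
    (hw0 : w 0 = a) (hw1 : w 1 = b)
    (hw : ∀ n : ℤ, w n = p * w (n - 1) - q * w (n - 2))
    (hu0 : u 0 = 0) (hu1 : u 1 = 1)
    (hu : ∀ n : ℤ, u n = p * u (n - 1) - q * u (n - 2))
    (k : ℕ) (r s n m : ℤ) :
    ∑ j ∈ Finset.range (k + 1), (-1) ^ j * (k.choose j : ℂ) * u (r - s) ^ j * u (m - s) ^ (k - j) * w (n + (r - s) * k + (m - r) * j) = q ^ ((r - s) * (k : ℤ)) * u (m - r) ^ k * w n := by
  have shift : ∀ f : ℤ → ℂ, (∀ n, f n = p * f (n - 1) - q * f (n - 2)) →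
      ∀ n, f (n + 2) = p * f (n + 1) - q * f n := by
    intro f hf n
    rw [hf (n + 2), show n + 2 - 1 = n + 1 by ring, add_sub_cancel_right]
  have docagne : ∀ n, u (m - s) * w (n + (r - s)) + -u (r - s) * w (n + (m - s)) =
      q ^ (r - s) * u (m - r) * w n := by
    intro n
    have h := horadam_docagne hq (shift w hw) (shift u hu) hu0 hu1 n (r - s) (m - s)
    rw [sub_sub_sub_cancel_right] at h
    linear_combination h
  rw [zpow_mul, zpow_natCast, ← mul_pow, ← sum_choose_mul_shift docagne k n]
  refine Finset.sum_congr rfl fun j hj => ?_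
  have hjk : j ≤ k := Nat.lt_succ_iff.mp (Finset.mem_range.mp hj)
  rw [neg_pow (u (r - s)), Nat.cast_sub hjk,
    show n + (r - s) * ((k : ℤ) - j) + (m - s) * j = n + (r - s) * k + (m - r) * j by ring]
  ring
end
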